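/- arXiv:1902.10337 — 3 statements merged into one kernel-verified Lean document; each statement's English description precedes it below -/
import Mathlib

section
/- Let G be a simple graph on n ≥ 3 vertices, let H be a Hamiltonian cycle of G, and let L be a circle ordering of G with a gap {x, y}. Suppose {x, a} is an edge of H that is a ladder of L, and write L cyclically as (x, …, b, a, …, y, x), where b is the circle-neighbour of a lying on the segment that runs from a through x to y. If {a, b} is not an edge of H, then the ordering L′ = (b, …, x, a, …, y, b) obtained by the γ-move reversing the segment (x, …, b) satisfies dist(L′, H) ≤ dist(L, H) − 1 and g(L′) ≤ g(L). -/
variable {V : Type*}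

/-- The adjacent pairs of a circle ordering `L`: the unordered pairs
`{vᵢ, vᵢ₊₁}` (indices mod `L.length`). -/
def adjPairs (L : List V) : List (Sym2 V) :=
  (L.zip (L.rotate 1)).map (fun p => s(p.1, p.2))

/-- `L` is a circle ordering of the vertex set `V`: a list containing every
vertex exactly once, regarded cyclically. -/
def IsCircleOrdering [Fintype V] (L : List V) : Prop :=
  L.Nodup ∧ ∀ v : V, v ∈ L

/-- `g(L)`: the number of gaps of `L`, i.e. adjacent pairs of `L` that are
not edges of `G`. -/
noncomputable def numGaps (G : SimpleGraph V) (L : List V) : ℕ :=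
  (adjPairs L).countP (fun e => @decide (e ∉ G.edgeSet) (Classical.propDecidable _))

/-- `dist(L, H) = n - (number of adjacent pairs of `L` lying in the edge set `H`)`. -/
noncomputable def distTo (H : Set (Sym2 V)) (L : List V) : ℕ :=
  L.length - (adjPairs L).countP (fun e => @decide (e ∈ H) (Classical.propDecidable _))

/-- `Δ(L, H) = g(L)/3 + dist(L, H)`. -/
noncomputable def delta (G : SimpleGraph V) (H : Set (Sym2 V)) (L : List V) : ℚ :=
  (numGaps G L : ℚ) / 3 + (distTo H L : ℚ)

/-- Two circle orderings are equivalent iff one is obtained from the other by a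
cyclic rotation, a reversal of the order, or a composition of both. -/
def OrderEquiv (L M : List V) : Prop :=
  (∃ k, M = L.rotate k) ∨ (∃ k, M = L.reverse.rotate k)

/-- A γ-move maps an ordering `A ++ B` (with `A`, `B` nonempty) to
`A.reverse ++ B`. -/
def GammaMove (L M : List V) : Prop :=
  ∃ A B : List V, A ≠ [] ∧ B ≠ [] ∧ L = A ++ B ∧ M = A.reverse ++ B

/-- A κ-move maps an ordering `A ++ B ++ C ++ D` (with `A`, `B`, `D` nonempty,
`C` possibly empty) to `A.reverse ++ B.reverse ++ D ++ C.reverse`. -/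
def KappaMove (L M : List V) : Prop :=
  ∃ A B C D : List V, A ≠ [] ∧ B ≠ [] ∧ D ≠ [] ∧
    L = A ++ B ++ C ++ D ∧ M = A.reverse ++ B.reverse ++ D ++ C.reverse

/-- A γ-move applied up to equivalence: the ordering may first be replaced by
any equivalent ordering. -/
def GammaStep (L M : List V) : Prop := ∃ L', OrderEquiv L L' ∧ GammaMove L' M

/-- A κ-move applied up to equivalence. -/
def KappaStep (L M : List V) : Prop := ∃ L', OrderEquiv L L' ∧ KappaMove L' M

/-- `M` is obtained from `L` by applying at most one κ-move and at most one
γ-move (in some order), each up to equivalence. -/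
def KGStep (L M : List V) : Prop :=
  OrderEquiv L M ∨ GammaStep L M ∨ KappaStep L M ∨
    (∃ K, KappaStep L K ∧ GammaStep K M) ∨
    (∃ K, GammaStep L K ∧ KappaStep K M)

/-- The unordered pairs of consecutive entries of a list, read without wrapping around. -/
def pathPairs : List V → List (Sym2 V)
  | [] => []
  | [_] => []
  | u :: w :: l => s(u, w) :: pathPairs (w :: l)

theorem pathPairs_append {A B : List V} {b a : V} (hA : A.getLast? = some b)
    (hB : B.head? = some a) :
    pathPairs (A ++ B) = pathPairs A ++ s(b, a) :: pathPairs B := by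
  induction A with
  | nil => simp at hA
  | cons u A ih =>
    cases A with
    | nil =>
      obtain ⟨B, rfl⟩ := List.head?_eq_some_iff.mp hB
      simp_all [pathPairs]
    | cons w A => simpa [pathPairs] using ih (by simpa using hA)

theorem pathPairs_reverse (L : List V) : pathPairs L.reverse = (pathPairs L).reverse := by
  induction L with
  | nil => rfl
  | cons u L ih =>
    cases L with
    | nil => rfl
    | cons w L =>
      rw [List.reverse_cons, pathPairs_append (b := w) (a := u) (by simp) rfl, ih]
      simp [pathPairs, Sym2.eq_swap]

theorem map_zip_eq_pathPairs (u z : V) (L : List V) :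
    ((u :: L).zip (L ++ [z])).map (fun p => s(p.1, p.2)) = pathPairs (u :: L ++ [z]) := by
  induction L generalizing u with
  | nil => rfl
  | cons w L ih => simpa [pathPairs] using ih w

theorem adjPairs_eq_pathPairs {L : List V} {x : V} (hx : L.head? = some x) :
    adjPairs L = pathPairs (L ++ [x]) := by
  obtain ⟨L, rfl⟩ := List.head?_eq_some_iff.mp hx
  simpa [adjPairs] using map_zip_eq_pathPairs x x L

theorem adjPairs_append {A B : List V} {x b a y : V} (hx : A.head? = some x)
    (hb : A.getLast? = some b) (ha : B.head? = some a) (hy : B.getLast? = some y) :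
    adjPairs (A ++ B) = pathPairs A ++ s(b, a) :: (pathPairs B ++ [s(y, x)]) := by
  rw [adjPairs_eq_pathPairs (x := x) (by simp [hx]), List.append_assoc,
    pathPairs_append hb (a := a) (by simp [ha]), pathPairs_append hy (a := x) rfl]
  rfl

theorem length_adjPairs (L : List V) : (adjPairs L).length = L.length := by
  simp [adjPairs]

/-- with a gap `{x,y}`, an `H`-edge `{x,a}` that is a ladder of
`L = (x,…,b,a,…,y)`, and `{a,b} ∉ H`, the γ-move reversing the segment
`(x,…,b)` decreases the distance to `H` by at least 1 and does not increase
the number of gaps. -/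
theorem stmt4 [Fintype V] [DecidableEq V] (G : SimpleGraph V)
    (hn : 3 ≤ Fintype.card V)
    {v : V} (p : G.Walk v v) (hp : p.IsHamiltonianCycle)
    (X Y : List V) (x b a y : V)
    (hX : X ≠ []) (hY : Y ≠ [])
    (hx : X.head? = some x) (hb : X.getLast? = some b)
    (ha : Y.head? = some a) (hy : Y.getLast? = some y)
    (hL : IsCircleOrdering (X ++ Y))
    (hgap : s(x, y) ∉ G.edgeSet)
    (hxaH : s(x, a) ∈ p.edges)
    (hxaLadder : s(x, a) ∉ adjPairs (X ++ Y))
    (habH : s(a, b) ∉ p.edges) :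
    distTo {e | e ∈ p.edges} (X.reverse ++ Y) + 1 ≤
        distTo {e | e ∈ p.edges} (X ++ Y) ∧
      numGaps G (X.reverse ++ Y) ≤ numGaps G (X ++ Y) := by
  have hold := adjPairs_append hx hb ha hy
  have hnew : adjPairs (X.reverse ++ Y) =
      (pathPairs X).reverse ++ s(x, a) :: (pathPairs Y ++ [s(y, b)]) := by
    rw [← pathPairs_reverse]
    exact adjPairs_append (by simp [hb]) (by simp [hx]) ha hy
  have hxaG : s(x, a) ∈ G.edgeSet := p.edges_subset_edgeSet hxaH
  have hyxG : s(y, x) ∉ G.edgeSet := by rwa [Sym2.eq_swap]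
  have hyxH : s(y, x) ∉ p.edges := fun h => hyxG (p.edges_subset_edgeSet h)
  have hbaH : s(b, a) ∉ p.edges := by rwa [Sym2.eq_swap]
  constructor
  · have hlen := length_adjPairs (X ++ Y)
    rw [hold] at hlen
    have hcX := List.countP_le_length (p := fun e => decide (e ∈ p.edges)) (l := pathPairs X)
    have hcY := List.countP_le_length (p := fun e => decide (e ∈ p.edges)) (l := pathPairs Y)
    simp only [List.length_append, List.length_cons, List.length_nil] at hlen
    simp only [distTo, hold, hnew, Set.mem_ofPred_eq, List.countP_append, List.countP_cons,
      List.countP_nil, List.countP_reverse, List.length_append, List.length_reverse,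
      hxaH, hyxH, hbaH, decide_true, decide_false]
    grind
  · simp only [numGaps, hold, hnew, List.countP_append, List.countP_cons, List.countP_nil,
      List.countP_reverse, hxaG, hyxG, not_true_eq_false, not_false_eq_true,
      decide_true, decide_false]
    grind
end

section
/- (SLH floating 4-flo type 1.) Let G be a simple graph on n ≥ 3 vertices and let L be a circle ordering of G written cyclically as L = A ++ B ++ C ++ D, where A = (x, …, e), B = (c, …, a), C = (b, …, d) and D = (f, …, y) are nonempty segments. Suppose {y, x} is a gap of L and {x, a}, {b, y} and {c, d} are edges of G. Then the circle ordering L′ = C.reverse ++ D.reverse ++ A.reverse ++ B.reverse = (d, …, b, y, …, f, e, …, x, a, …, c) satisfies g(L′) ≤ g(L); if moreover {e, f} is an edge of G, then g(L′) ≤ g(L) − 1. -/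
variable {V : Type*}

open Classical in
/-- The gap indicator of an unordered pair: `1` if it is not an edge of `G`, else `0`. -/
noncomputable def gapIndicator (G : SimpleGraph V) (p : Sym2 V) : ℕ :=
  if p ∈ G.edgeSet then 0 else 1

/-- The number of gaps along a list of vertices read as a path (no wrap-around pair). -/
noncomputable def pathGaps (G : SimpleGraph V) : List V → ℕ
  | [] => 0
  | [_] => 0
  | u :: v :: l => gapIndicator G s(u, v) + pathGaps G (v :: l)

theorem pathGaps_append (G : SimpleGraph V) {L M : List V} {u v : V}
    (hu : L.getLast? = some u) (hv : M.head? = some v) :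
    pathGaps G (L ++ M) = pathGaps G L + gapIndicator G s(u, v) + pathGaps G M := by
  induction L with
  | nil => simp at hu
  | cons w L ih =>
    cases L with
    | nil =>
      cases M with
      | nil => simp at hv
      | cons z M =>
        simp only [List.getLast?_singleton, Option.some.injEq, List.head?_cons] at hu hv
        subst hu hv
        simp [pathGaps]
    | cons z L =>
      have h := ih (by simpa using hu)
      simp only [List.cons_append, pathGaps] at h ⊢
      omega

theorem pathGaps_reverse (G : SimpleGraph V) (L : List V) :
    pathGaps G L.reverse = pathGaps G L := by
  induction L with
  | nil => rfl
  | cons u L ih =>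
    cases L with
    | nil => rfl
    | cons v L =>
      rw [List.reverse_cons, pathGaps_append G (u := v) (v := u) (by simp) (by simp), ih,
        Sym2.eq_swap]
      simp only [pathGaps]
      omega

theorem countP_zip_eq_pathGaps (G : SimpleGraph V) (u v : V) (l : List V) :
    (((u :: l).zip (l ++ [v])).map (fun p => s(p.1, p.2))).countP
      (fun e => @decide (e ∉ G.edgeSet) (Classical.propDecidable _)) =
      pathGaps G (u :: l ++ [v]) := by
  induction l generalizing u with
  | nil => by_cases h : G.Adj u v <;> simp [pathGaps, gapIndicator, h]
  | cons w l ih =>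
    have h := ih w
    simp only [List.cons_append, List.zip_cons_cons, List.map_cons, List.countP_cons,
      pathGaps] at h ⊢
    rw [h]
    by_cases h' : G.Adj u w <;> simp [gapIndicator, h', Nat.add_comm]

theorem numGaps_eq_pathGaps_add (G : SimpleGraph V) {L : List V} {u v : V}
    (hu : L.head? = some u) (hv : L.getLast? = some v) :
    numGaps G L = pathGaps G L + gapIndicator G s(v, u) := by
  cases L with
  | nil => simp at hu
  | cons w l =>
    obtain rfl : w = u := by simpa using hu
    have h := pathGaps_append G hv (M := [w]) (v := w) rfl
    rw [numGaps, adjPairs, List.rotate_cons_succ, List.rotate_zero,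
      countP_zip_eq_pathGaps, h]
    simp [pathGaps]

theorem numGaps_append_four (G : SimpleGraph V) {A B C D : List V} {x e c a b d f y : V}
    (hx : A.head? = some x) (he : A.getLast? = some e)
    (hc : B.head? = some c) (ha : B.getLast? = some a)
    (hb : C.head? = some b) (hd : C.getLast? = some d)
    (hf : D.head? = some f) (hy : D.getLast? = some y) :
    numGaps G (A ++ B ++ C ++ D) =
      pathGaps G A + pathGaps G B + pathGaps G C + pathGaps G D +
        gapIndicator G s(e, c) + gapIndicator G s(a, b) +
        gapIndicator G s(d, f) + gapIndicator G s(y, x) := by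
  rw [numGaps_eq_pathGaps_add G (u := x) (v := y) (by simp [hx]) (by simp [hy]),
    pathGaps_append G (u := d) (v := f) (by simp [hd]) hf,
    pathGaps_append G (u := a) (v := b) (by simp [ha]) hb,
    pathGaps_append G he hc]
  omega

/-- SLH floating 4-flo type 1: for
`L = (x,…,e) ++ (c,…,a) ++ (b,…,d) ++ (f,…,y)` with gap `{y,x}` and edges
`{x,a}`, `{b,y}`, `{c,d}`, the ordering `(d,…,b,y,…,f,e,…,x,a,…,c)` has no
more gaps; if moreover `{e,f}` is an edge, it has at least one gap fewer. -/
theorem stmt12 [Fintype V] (G : SimpleGraph V) (hn : 3 ≤ Fintype.card V)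
    (A B C D : List V) (x e c a b d f y : V)
    (hA : A ≠ []) (hB : B ≠ []) (hC : C ≠ []) (hD : D ≠ [])
    (hx : A.head? = some x) (he : A.getLast? = some e)
    (hc : B.head? = some c) (ha : B.getLast? = some a)
    (hb : C.head? = some b) (hd : C.getLast? = some d)
    (hf : D.head? = some f) (hy : D.getLast? = some y)
    (hL : IsCircleOrdering (A ++ B ++ C ++ D))
    (hgap : s(y, x) ∉ G.edgeSet)
    (hedge1 : s(x, a) ∈ G.edgeSet) (hedge2 : s(b, y) ∈ G.edgeSet)
    (hedge3 : s(c, d) ∈ G.edgeSet) :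
    numGaps G (C.reverse ++ D.reverse ++ A.reverse ++ B.reverse) ≤
        numGaps G (A ++ B ++ C ++ D) ∧
      (s(e, f) ∈ G.edgeSet →
        numGaps G (C.reverse ++ D.reverse ++ A.reverse ++ B.reverse) + 1 ≤
          numGaps G (A ++ B ++ C ++ D)) := by
  rw [numGaps_append_four G hx he hc ha hb hd hf hy,
    numGaps_append_four G (A := C.reverse) (B := D.reverse) (C := A.reverse) (D := B.reverse)
      (x := d) (e := b) (c := y) (a := f) (b := e) (d := x) (f := a) (y := c)
      (by simpa) (by simpa) (by simpa) (by simpa) (by simpa) (by simpa) (by simpa) (by simpa)]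
  simp only [pathGaps_reverse]
  have hyx : gapIndicator G s(y, x) = 1 := if_neg hgap
  have hxa : gapIndicator G s(x, a) = 0 := if_pos hedge1
  have hby : gapIndicator G s(b, y) = 0 := if_pos hedge2
  have hcd : gapIndicator G s(c, d) = 0 := if_pos hedge3
  have hfe : gapIndicator G s(f, e) ≤ 1 := by
    unfold gapIndicator
    split <;> simp
  refine ⟨by omega, fun hef => ?_⟩
  have hfe' : gapIndicator G s(f, e) = 0 := if_pos (by rwa [Sym2.eq_swap])
  omega
end

section
/- (SLH opening 4-flo.) Let G be a simple graph on n ≥ 3 vertices and let L be a circle ordering of G written cyclically as L = A ++ B ++ C ++ D, where A = (x, …, e), B = (c, …, a), C = (b, …, f) and D = (d, …, y) are nonempty segments (possibly of length one). Suppose {y, x} is a gap of L and {x, a} and {c, d} are edges of G. Then the circle ordering L′ = A.reverse ++ B.reverse ++ D ++ C.reverse = (e, …, x, a, …, c, d, …, y, f, …, b) satisfies g(L′) ≤ g(L) + 1. -/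
variable {V : Type*}

/-- The unordered pairs of consecutive entries of a list, read linearly. -/
def consecutivePairs : List V → List (Sym2 V)
  | [] => []
  | [_] => []
  | u :: v :: l => s(u, v) :: consecutivePairs (v :: l)

theorem consecutivePairs_append {l m : List V} {u v : V}
    (hu : l.getLast? = some u) (hv : m.head? = some v) :
    consecutivePairs (l ++ m) = consecutivePairs l ++ s(u, v) :: consecutivePairs m := by
  induction l with
  | nil => simp at hu
  | cons w l ih =>
    cases l with
    | nil =>
      cases m with
      | nil => simp at hv
      | cons z m =>
        simp only [List.getLast?_singleton, Option.some.injEq, List.head?_cons] at hu hv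
        subst hu hv
        simp [consecutivePairs]
    | cons z l =>
      rw [List.getLast?_cons_cons] at hu
      have h := ih hu
      simp only [List.cons_append] at h
      simp [consecutivePairs, h]

theorem consecutivePairs_reverse (l : List V) :
    consecutivePairs l.reverse = (consecutivePairs l).reverse := by
  induction l with
  | nil => rfl
  | cons w l ih =>
    cases l with
    | nil => rfl
    | cons z l =>
      rw [List.reverse_cons,
        consecutivePairs_append (u := z) (v := w) (by simp) (by simp), ih]
      simp [consecutivePairs, Sym2.eq_swap]

theorem map_zip_append_singleton (u w : V) (l : List V) :
    ((u :: l).zip (l ++ [w])).map (fun p => s(p.1, p.2)) =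
      consecutivePairs (u :: l ++ [w]) := by
  induction l generalizing u with
  | nil => rfl
  | cons z l ih =>
    have h := ih z
    simp only [List.cons_append] at h
    simp [consecutivePairs, ← h]

theorem adjPairs_eq_consecutivePairs {l : List V} {u v : V}
    (hu : l.head? = some u) (hv : l.getLast? = some v) :
    adjPairs l = consecutivePairs l ++ [s(v, u)] := by
  cases l with
  | nil => simp at hu
  | cons z l =>
    simp only [List.head?_cons, Option.some.injEq] at hu
    subst hu
    have h := consecutivePairs_append (m := [z]) hv rfl
    rw [adjPairs, List.rotate_cons_succ, List.rotate_zero, map_zip_append_singleton, h]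
    rfl

/-- The adjacent pairs of a circle ordering cut into four segments. -/
theorem adjPairs_append_four {A B C D : List V} {a₁ a₂ b₁ b₂ c₁ c₂ d₁ d₂ : V}
    (ha₁ : A.head? = some a₁) (ha₂ : A.getLast? = some a₂)
    (hb₁ : B.head? = some b₁) (hb₂ : B.getLast? = some b₂)
    (hc₁ : C.head? = some c₁) (hc₂ : C.getLast? = some c₂)
    (hd₁ : D.head? = some d₁) (hd₂ : D.getLast? = some d₂) :
    adjPairs (A ++ B ++ C ++ D) =
      consecutivePairs A ++ s(a₂, b₁) :: consecutivePairs B ++ s(b₂, c₁) :: consecutivePairs C ++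
        s(c₂, d₁) :: consecutivePairs D ++ [s(d₂, a₁)] := by
  rw [adjPairs_eq_consecutivePairs (u := a₁) (v := d₂) (by simp [ha₁]) (by simp [hd₂]),
    consecutivePairs_append (u := c₂) (v := d₁) (by simp [hc₂]) hd₁,
    consecutivePairs_append (u := b₂) (v := c₁) (by simp [hb₂]) hc₁,
    consecutivePairs_append ha₂ hb₁]

/-- SLH opening 4-flo: for
`L = (x,…,e) ++ (c,…,a) ++ (b,…,f) ++ (d,…,y)` with gap `{y,x}` and edges
`{x,a}`, `{c,d}`, the ordering `(e,…,x,a,…,c,d,…,y,f,…,b)` has at most one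
more gap. -/
theorem stmt15 [Fintype V] (G : SimpleGraph V) (hn : 3 ≤ Fintype.card V)
    (A B C D : List V) (x e c a b f d y : V)
    (hA : A ≠ []) (hB : B ≠ []) (hC : C ≠ []) (hD : D ≠ [])
    (hx : A.head? = some x) (he : A.getLast? = some e)
    (hc : B.head? = some c) (ha : B.getLast? = some a)
    (hb : C.head? = some b) (hf : C.getLast? = some f)
    (hd : D.head? = some d) (hy : D.getLast? = some y)
    (hL : IsCircleOrdering (A ++ B ++ C ++ D))
    (hgap : s(y, x) ∉ G.edgeSet)
    (hedge1 : s(x, a) ∈ G.edgeSet) (hedge2 : s(c, d) ∈ G.edgeSet) :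
    numGaps G (A.reverse ++ B.reverse ++ D ++ C.reverse) ≤
      numGaps G (A ++ B ++ C ++ D) + 1 := by
  unfold numGaps
  rw [adjPairs_append_four hx he hc ha hb hf hd hy,
    adjPairs_append_four (a₁ := e) (a₂ := x) (b₁ := a) (b₂ := c) (c₁ := d) (c₂ := y)
      (d₁ := f) (d₂ := b) (by simp [he]) (by simp [hx]) (by simp [ha]) (by simp [hc])
      hd hy (by simp [hf]) (by simp [hb])]
  simp only [consecutivePairs_reverse, List.countP_append, List.countP_cons, List.countP_nil,
    List.countP_reverse, decide_eq_true_eq, hgap, hedge1, hedge2, not_true_eq_false,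
    not_false_eq_true, if_true, if_false]
  split_ifs <;> omega
end
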